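/- Upper bound on the value of privacy (Theorem 2): For every ε > 0 there exists a constant C > 0 such that for every N ≥ 2 there is a nonnegative payment mechanism R : X^N → ℝ^N in which the strategy profile σ^(ε) consisting of N copies of the ε-strategy is a Nash equilibrium, and the expected payment to each individual i at this equilibrium satisfies E_{σ^(ε)}[R_i(X)] ≤ V_LB(ε) + C·e^{−N·d}, where d = (1/2)·ln((e^ε+1)²/(4(θe^ε+1−θ)((1−θ)e^ε+θ))) > 0. -/

import Mathlib

open Real

/-- The set of possible reports: `some b` is report `b ∈ {0,1}`, `none` is nonparticipation `⊥`. -/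
abbrev Report := Option Bool

/-- A (behavioral) strategy: a conditional distribution of the report given the signal. -/
def IsStrategy (σ : Bool → Report → ℝ) : Prop :=
  (∀ s x, 0 ≤ σ s x) ∧ ∀ s, ∑ x : Report, σ s x = 1

/-- `P_σ(X ∈ E | S = s)`. -/
def probE (σ : Bool → Report → ℝ) (E : Finset Report) (s : Bool) : ℝ :=
  ∑ x ∈ E, σ s x

/-- One log-likelihood-ratio term `ln(a/b)`, with the convention `0/0 = 1`,
clamped into `[0,∞]` (this does not change the supremum defining the privacy level,
since the supremum is always ≥ 0). -/
noncomputable def llr (a b : ℝ) : ENNReal :=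
  if a = 0 ∧ b = 0 then 0
  else if b = 0 then ⊤
  else ENNReal.ofReal (Real.log (a / b))

/-- The (local) differential privacy level `ζ(σ)` of a strategy, valued in `[0,∞]`. -/
noncomputable def privLevel (σ : Bool → Report → ℝ) : ENNReal :=
  ⨆ (E : Finset Report), ⨆ (s : Bool), llr (probE σ E s) (probE σ E (!s))

/-- The privacy cost `g(ζ(σ))`, valued in extended reals (at `ζ = ∞` we take the
supremum extension of `g`). -/
noncomputable def privCost (g : ℝ → ℝ) (σ : Bool → Report → ℝ) : EReal :=
  if privLevel σ = ⊤ then ⨆ x ∈ Set.Ici (0:ℝ), ((g x : ℝ) : EReal)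
  else ((g (privLevel σ).toReal : ℝ) : EReal)

/-- `P(S_i = s | W = w) = θ` if `s = w`, else `1 - θ`. -/
def signalProb (θ : ℝ) (w s : Bool) : ℝ := if s = w then θ else 1 - θ

/-- Joint probability of state `w`, signals `s` and reports `x`, where `p = P_W(1)`. -/
def jointProb {N : ℕ} (p θ : ℝ) (σ : Fin N → Bool → Report → ℝ)
    (w : Bool) (s : Fin N → Bool) (x : Fin N → Report) : ℝ :=
  (if w then p else 1 - p) * ∏ i, (signalProb θ w (s i) * σ i (s i) (x i))

/-- Expected payment `E_σ[R_i(X)]` to individual `i`. -/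
noncomputable def expPay {N : ℕ} (p θ : ℝ) (σ : Fin N → Bool → Report → ℝ)
    (R : (Fin N → Report) → Fin N → ℝ) (i : Fin N) : ℝ :=
  ∑ w : Bool, ∑ s : Fin N → Bool, ∑ x : Fin N → Report,
    jointProb p θ σ w s x * R x i

/-- Expected utility of individual `i`: expected payment minus privacy cost. -/
noncomputable def utility {N : ℕ} (p θ : ℝ) (g : ℝ → ℝ)
    (σ : Fin N → Bool → Report → ℝ)
    (R : (Fin N → Report) → Fin N → ℝ) (i : Fin N) : EReal :=
  ((expPay p θ σ R i : ℝ) : EReal) - privCost g (σ i)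

/-- `σ` is a Nash equilibrium of the payment mechanism `R`. -/
def NashEq {N : ℕ} (p θ : ℝ) (g : ℝ → ℝ)
    (σ : Fin N → Bool → Report → ℝ)
    (R : (Fin N → Report) → Fin N → ℝ) : Prop :=
  (∀ i, IsStrategy (σ i)) ∧
  ∀ (i : Fin N) (σ' : Bool → Report → ℝ), IsStrategy σ' →
    utility p θ g (Function.update σ i σ') R i ≤ utility p θ g σ R i

/-- The `ε`-strategy: symmetric randomized response flipping with prob. `1/(e^ε+1)`. -/
noncomputable def epsStrategy (ε : ℝ) : Bool → Report → ℝ :=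
  fun s x => match x with
  | none => 0
  | some b => if b = s then Real.exp ε / (Real.exp ε + 1) else 1 / (Real.exp ε + 1)

/-- The lower bound `V_LB(ε)` on the value of `ε` units of privacy. -/
noncomputable def VLB (θ : ℝ) (g' : ℝ → ℝ) (ε : ℝ) : ℝ :=
  g' ε * ((Real.exp ε + 1) / Real.exp ε) *
    ((θ / (2 * θ - 1)) * (Real.exp ε + 1) - 1)

/-- The hypotheses on the privacy cost function `g` (with derivative `g'`):
proper (nonnegative, `g(0) = 0`, non-decreasing), convex, continuously differentiable,
and vanishing only at `0`. -/
structure ProperCost (g g' : ℝ → ℝ) : Prop where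
  conv : ConvexOn ℝ (Set.Ici 0) g
  deriv : ∀ x ∈ Set.Ici (0:ℝ), HasDerivAt g (g' x) x
  derivCont : ContinuousOn g' (Set.Ici 0)
  mono : MonotoneOn g (Set.Ici 0)
  nonneg : ∀ x ∈ Set.Ici (0:ℝ), 0 ≤ g x
  zero : g 0 = 0
  pos : ∀ x > (0:ℝ), 0 < g x


/-- The exponent `d = (1/2)·ln((e^ε+1)²/(4(θe^ε+1−θ)((1−θ)e^ε+θ)))`. -/
noncomputable def dExp (θ ε : ℝ) : ℝ :=
  (1/2) * Real.log ((Real.exp ε + 1)^2 /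
    (4 * (θ * Real.exp ε + 1 - θ) * ((1 - θ) * Real.exp ε + θ)))


/-- `P_σ(X = x | W = w)`. -/
def reportProb (θ : ℝ) (τ : Bool → Report → ℝ) (w : Bool) (x : Report) : ℝ :=
  ∑ s : Bool, signalProb θ w s * τ s x

/-- The signals can be summed out of the joint distribution. -/
theorem expPay_eq_sum_reportProb {N : ℕ} (p θ : ℝ) (σ : Fin N → Bool → Report → ℝ)
    (R : (Fin N → Report) → Fin N → ℝ) (i : Fin N) :
    expPay p θ σ R i = ∑ w : Bool, (if w then p else 1 - p) *
      ∑ x : Fin N → Report, (∏ j, reportProb θ (σ j) w (x j)) * R x i := by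
  refine Finset.sum_congr rfl fun w _ => ?_
  rw [Finset.sum_comm, Finset.mul_sum]
  refine Finset.sum_congr rfl fun x _ => ?_
  simp only [jointProb, reportProb]
  rw [Finset.prod_univ_sum, Fintype.piFinset_univ, ← Finset.sum_mul, ← Finset.mul_sum, mul_assoc]

/-- Expected payment when individual `i` deviates to `τ'` and is paid according to her own report
and the reports of her peers. -/
theorem expPay_update {n : ℕ} (p θ : ℝ) (τ τ' : Bool → Report → ℝ)
    (h : Report → (Fin n → Report) → ℝ) (i : Fin (n + 1)) :
    expPay p θ (Function.update (fun _ => τ) i τ') (fun x i => h (x i) (i.removeNth x)) i =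
      ∑ w : Bool, (if w then p else 1 - p) * ∑ a : Report, reportProb θ τ' w a *
        ∑ y : Fin n → Report, (∏ k, reportProb θ τ w (y k)) * h a y := by
  rw [expPay_eq_sum_reportProb]
  refine Finset.sum_congr rfl fun w _ => ?_
  congr 1
  rw [← (Fin.insertNthEquiv (fun _ => Report) i).sum_comp, Fintype.sum_prod_type]
  refine Finset.sum_congr rfl fun a _ => ?_
  rw [Finset.mul_sum]
  refine Finset.sum_congr rfl fun y _ => ?_
  rw [Fin.prod_univ_succAbove _ i]
  simp [Fin.insertNthEquiv, mul_assoc]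

/-- A convex function lies above its tangents. -/
theorem ConvexOn.tangent_le {S : Set ℝ} {f : ℝ → ℝ} {f' a x : ℝ} (hf : ConvexOn ℝ S f)
    (ha : a ∈ S) (hx : x ∈ S) (hd : HasDerivAt f f' a) : f a + f' * (x - a) ≤ f x := by
  rcases lt_trichotomy a x with h | rfl | h
  · have := hf.le_slope_of_hasDerivAt ha hx h hd
    rw [slope_def_field, le_div_iff₀ (by linarith)] at this
    linarith
  · simp
  · have := hf.slope_le_of_hasDerivAt hx ha h hd
    rw [slope_def_field, div_le_iff₀ (by linarith)] at this
    linarith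

theorem hasDerivAt_exp_sub_one_div_exp_add_one (x : ℝ) :
    HasDerivAt (fun x => (exp x - 1) / (exp x + 1)) (2 * exp x / (exp x + 1) ^ 2) x := by
  have h := ((hasDerivAt_exp x).sub_const 1).div ((hasDerivAt_exp x).add_const 1)
    (by positivity)
  exact h.congr_deriv (by ring)

theorem concaveOn_exp_sub_one_div_exp_add_one :
    ConcaveOn ℝ (Set.Ici 0) fun x => (exp x - 1) / (exp x + 1) := by
  refine AntitoneOn.concaveOn_of_deriv (convex_Ici 0)
    (fun x _ => (hasDerivAt_exp_sub_one_div_exp_add_one x).continuousAt.continuousWithinAt)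
    (fun x _ => (hasDerivAt_exp_sub_one_div_exp_add_one x).differentiableAt.differentiableWithinAt)
    fun x hx y _ hxy => ?_
  rw [interior_Ici, Set.mem_Ioi] at hx
  rw [(hasDerivAt_exp_sub_one_div_exp_add_one x).deriv,
    (hasDerivAt_exp_sub_one_div_exp_add_one y).deriv,
    div_le_div_iff₀ (by positivity) (by positivity)]
  have hu := one_lt_exp_iff.2 hx
  have huv := exp_le_exp.2 hxy
  nlinarith [mul_nonneg (sub_nonneg.2 huv) (by nlinarith : (0 : ℝ) ≤ exp x * exp y - 1)]

theorem tangent_ge_exp_sub_one_div_exp_add_one {a x : ℝ} (ha : 0 ≤ a) (hx : 0 ≤ x) :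
    (exp x - 1) / (exp x + 1) ≤
      (exp a - 1) / (exp a + 1) + 2 * exp a / (exp a + 1) ^ 2 * (x - a) := by
  have h := concaveOn_exp_sub_one_div_exp_add_one.neg.tangent_le (Set.mem_Ici.2 ha)
    (Set.mem_Ici.2 hx) (hasDerivAt_exp_sub_one_div_exp_add_one a).neg
  simp only [Pi.neg_apply] at h
  linarith

theorem llr_le_ofReal {a b ξ : ℝ} (ha : 0 ≤ a) (hb : 0 ≤ b) (h : a ≤ exp ξ * b) :
    llr a b ≤ ENNReal.ofReal ξ := by
  unfold llr
  split_ifs with h1 h2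
  · exact zero_le
  · exact absurd ⟨le_antisymm (by simpa [h2] using h) ha, h2⟩ h1
  · have hb' : 0 < b := lt_of_le_of_ne hb (Ne.symm h2)
    rcases ha.eq_or_lt with rfl | ha'
    · simp
    · refine ENNReal.ofReal_le_ofReal ((log_le_iff_le_exp (by positivity)).2 ?_)
      rwa [div_le_iff₀ hb']

theorem le_exp_mul_of_llr_le_ofReal {a b ξ : ℝ} (ha : 0 ≤ a) (hb : 0 ≤ b) (hξ : 0 ≤ ξ)
    (h : llr a b ≤ ENNReal.ofReal ξ) : a ≤ exp ξ * b := by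
  unfold llr at h
  split_ifs at h with h1 h2
  · simp [h1.1, h1.2]
  · simp at h
  · have hb' : 0 < b := lt_of_le_of_ne hb (Ne.symm h2)
    rcases ha.eq_or_lt with rfl | ha'
    · positivity
    · rwa [ENNReal.ofReal_le_ofReal_iff hξ, log_le_iff_le_exp (by positivity),
        div_le_iff₀ hb'] at h

theorem probE_le_exp_privLevel_mul {τ : Bool → Report → ℝ} (hτ : ∀ s x, 0 ≤ τ s x)
    (h : privLevel τ ≠ ⊤) (E : Finset Report) (s : Bool) :
    probE τ E s ≤ exp (privLevel τ).toReal * probE τ E (!s) := by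
  refine le_exp_mul_of_llr_le_ofReal (Finset.sum_nonneg fun _ _ => hτ _ _)
    (Finset.sum_nonneg fun _ _ => hτ _ _) ENNReal.toReal_nonneg ?_
  rw [ENNReal.ofReal_toReal h]
  exact le_iSup₂_of_le E s le_rfl

theorem isStrategy_epsStrategy (ε : ℝ) : IsStrategy (epsStrategy ε) := by
  constructor
  · rintro s (_ | b)
    · exact le_rfl
    · simp only [epsStrategy]
      split_ifs <;> positivity
  · have : exp ε + 1 ≠ 0 := by positivity
    rintro (_ | _) <;> simp [Fintype.sum_option, epsStrategy] <;> field_simp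
    ring

theorem privLevel_epsStrategy_le {ε : ℝ} (hε : 0 ≤ ε) :
    privLevel (epsStrategy ε) ≤ ENNReal.ofReal ε := by
  have h0 := (isStrategy_epsStrategy ε).1
  refine iSup₂_le fun E s => llr_le_ofReal (Finset.sum_nonneg fun _ _ => h0 _ _)
    (Finset.sum_nonneg fun _ _ => h0 _ _) ?_
  unfold probE
  rw [Finset.mul_sum]
  refine Finset.sum_le_sum fun x _ => ?_
  have h1 := one_le_exp hε
  have h2 : exp ε / (exp ε + 1) ≤ exp ε * (exp ε + 1)⁻¹ := le_of_eq (by ring)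
  have h3 : (exp ε + 1)⁻¹ ≤ exp ε * (exp ε / (exp ε + 1)) := by
    rw [← mul_div_assoc, inv_eq_one_div]
    gcongr
    nlinarith
  rcases x with _ | b
  · simp [epsStrategy]
  · cases b <;> cases s <;> simpa [epsStrategy] using by first | exact h2 | exact h3

/-- The accuracy advantage `P(X = 0 | S = 0) - P(X = 0 | S = 1)` of a strategy is bounded in terms
of its privacy level. -/
theorem sub_le_of_privLevel {τ : Bool → Report → ℝ} (hτ : IsStrategy τ) (h : privLevel τ ≠ ⊤) :
    τ false (some false) - τ true (some false) ≤
      (exp (privLevel τ).toReal - 1) / (exp (privLevel τ).toReal + 1) := by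
  have h1 := probE_le_exp_privLevel_mul hτ.1 h {some false} false
  have h2 := probE_le_exp_privLevel_mul hτ.1 h {some true, none} true
  have s0 := hτ.2 false
  have s1 := hτ.2 true
  simp [probE, Fintype.sum_option] at h1 h2 s0 s1
  rw [le_div_iff₀ (by positivity)]
  have e1 : τ true (some true) + τ true none = 1 - τ true (some false) := by linarith
  have e2 : τ false (some true) + τ false none = 1 - τ false (some false) := by linarith
  rw [e1, e2] at h2
  linarith

/-- Bhattacharyya bound on the total error of the maximum likelihood test between two product
distributions. -/
theorem sum_min_prod_le {α : Type*} [Fintype α] {q₀ q₁ : α → ℝ} (h₀ : ∀ a, 0 ≤ q₀ a)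
    (h₁ : ∀ a, 0 ≤ q₁ a) (n : ℕ) :
    ∑ y : Fin n → α, min (∏ k, q₀ (y k)) (∏ k, q₁ (y k)) ≤ (∑ a, √(q₀ a * q₁ a)) ^ n := by
  rw [Fintype.sum_pow]
  refine Finset.sum_le_sum fun y _ => ?_
  have hp₀ : 0 ≤ ∏ k, q₀ (y k) := Finset.prod_nonneg fun k _ => h₀ _
  have hp₁ : 0 ≤ ∏ k, q₁ (y k) := Finset.prod_nonneg fun k _ => h₁ _
  rw [← Real.sqrt_prod _ fun k _ => mul_nonneg (h₀ _) (h₁ _), Finset.prod_mul_distrib]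
  refine Real.le_sqrt_of_sq_le ?_
  rw [sq]
  exact mul_le_mul (min_le_left _ _) (min_le_right _ _) (le_min hp₀ hp₁) hp₀

theorem reportProb_nonneg {θ : ℝ} (hθ0 : 0 ≤ θ) (hθ1 : θ ≤ 1) {τ : Bool → Report → ℝ}
    (hτ : IsStrategy τ) (w : Bool) (x : Report) : 0 ≤ reportProb θ τ w x := by
  refine Finset.sum_nonneg fun s _ => mul_nonneg ?_ (hτ.1 s x)
  unfold signalProb
  split_ifs <;> linarith

theorem sum_reportProb (θ : ℝ) {τ : Bool → Report → ℝ} (hτ : IsStrategy τ) (w : Bool) :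
    ∑ x : Report, reportProb θ τ w x = 1 := by
  simp only [reportProb]
  rw [Finset.sum_comm]
  simp only [← Finset.mul_sum, hτ.2]
  cases w <;> simp [signalProb]

theorem dExp_ratio_gt_one {θ ε : ℝ} (hθ : 1 / 2 < θ) (hθ1 : θ < 1) (hε : 0 < ε) :
    1 < (exp ε + 1) ^ 2 / (4 * (θ * exp ε + 1 - θ) * ((1 - θ) * exp ε + θ)) := by
  have he := one_lt_exp_iff.2 hε
  have h1 : 0 < θ * exp ε + 1 - θ := by nlinarith
  have h2 : 0 < (1 - θ) * exp ε + θ := by nlinarith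
  rw [one_lt_div (by positivity)]
  have h3 : 0 < (2 * θ - 1) * (exp ε - 1) := mul_pos (by linarith) (by linarith)
  nlinarith [mul_pos h3 h3]

theorem dExp_pos {θ ε : ℝ} (hθ : 1 / 2 < θ) (hθ1 : θ < 1) (hε : 0 < ε) : 0 < dExp θ ε :=
  mul_pos (by norm_num) (log_pos (dExp_ratio_gt_one hθ hθ1 hε))

/-- `e^{-d}` is the Bhattacharyya coefficient of the report distributions in the two states. -/
theorem sum_sqrt_reportProb {θ ε : ℝ} (hθ : 1 / 2 < θ) (hθ1 : θ < 1) (hε : 0 < ε) :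
    ∑ a : Report, √(reportProb θ (epsStrategy ε) false a * reportProb θ (epsStrategy ε) true a) =
      exp (-dExp θ ε) := by
  have hX := dExp_ratio_gt_one hθ hθ1 hε
  have hsq : exp (-dExp θ ε) ^ 2 =
      4 * (θ * exp ε + 1 - θ) * ((1 - θ) * exp ε + θ) / (exp ε + 1) ^ 2 := by
    rw [← exp_nat_mul, dExp, ← inv_div ((exp ε + 1) ^ 2), ← exp_log (inv_pos.2 (one_pos.trans hX)), log_inv]
    congr 1
    push_cast
    ring
  have hpos : (exp ε + 1) ≠ 0 := by positivity
  have key : ∀ b : Bool, √(reportProb θ (epsStrategy ε) false (some b) *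
      reportProb θ (epsStrategy ε) true (some b)) = exp (-dExp θ ε) / 2 := by
    intro b
    rw [Real.sqrt_eq_iff_eq_sq _ (by positivity)]
    · rw [div_pow, hsq]
      cases b <;> simp [reportProb, epsStrategy, signalProb] <;> field_simp <;> ring
    · exact mul_nonneg
        (reportProb_nonneg (by linarith) hθ1.le (isStrategy_epsStrategy ε) _ _)
        (reportProb_nonneg (by linarith) hθ1.le (isStrategy_epsStrategy ε) _ _)
  rw [Fintype.sum_option, Fintype.sum_bool, key, key]
  simp [reportProb, epsStrategy]

/-- Likelihood of the peers' reports in state `w`, when they use the `ε`-strategy. -/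
noncomputable def peerLikelihood (θ ε : ℝ) {n : ℕ} (w : Bool) (y : Fin n → Report) : ℝ :=
  ∏ k, reportProb θ (epsStrategy ε) w (y k)

/-- Maximum likelihood estimate of the state from the peers' reports. -/
noncomputable def peerEstimate (θ ε : ℝ) {n : ℕ} (y : Fin n → Report) : Bool :=
  if peerLikelihood θ ε false y ≤ peerLikelihood θ ε true y then true else false

/-- Probability of the estimate `b` in state `w`. -/
noncomputable def estimateProb (θ ε : ℝ) (n : ℕ) (w b : Bool) : ℝ :=
  ∑ y : Fin n → Report, if peerEstimate θ ε y = b then peerLikelihood θ ε w y else 0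

/-- Peer prediction: pay `r b` for the report `b` if it agrees with the peers' estimate. -/
noncomputable def peerPayment (θ ε : ℝ) {n : ℕ} (r : Bool → ℝ) (a : Report)
    (y : Fin n → Report) : ℝ :=
  if a = some (peerEstimate θ ε y) then r (peerEstimate θ ε y) else 0

theorem peerLikelihood_nonneg {θ ε : ℝ} (hθ0 : 0 ≤ θ) (hθ1 : θ ≤ 1) {n : ℕ} (w : Bool)
    (y : Fin n → Report) : 0 ≤ peerLikelihood θ ε w y :=
  Finset.prod_nonneg fun _ _ => reportProb_nonneg hθ0 hθ1 (isStrategy_epsStrategy ε) _ _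

theorem estimateProb_nonneg {θ ε : ℝ} (hθ0 : 0 ≤ θ) (hθ1 : θ ≤ 1) (n : ℕ) (w b : Bool) :
    0 ≤ estimateProb θ ε n w b :=
  Finset.sum_nonneg fun y _ => by
    split_ifs
    exacts [peerLikelihood_nonneg hθ0 hθ1 w y, le_rfl]

theorem estimateProb_add (θ ε : ℝ) (n : ℕ) (w : Bool) :
    estimateProb θ ε n w true + estimateProb θ ε n w false = 1 := by
  unfold estimateProb
  rw [← Finset.sum_add_distrib]
  calc _ = ∑ y : Fin n → Report, peerLikelihood θ ε w y :=
        Finset.sum_congr rfl fun y _ => by cases peerEstimate θ ε y <;> simp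
    _ = 1 := by
        simp only [peerLikelihood]
        rw [← Fintype.sum_pow, sum_reportProb θ (isStrategy_epsStrategy ε), one_pow]

theorem estimateProb_error_le {θ ε : ℝ} (hθ : 1 / 2 < θ) (hθ1 : θ < 1) (hε : 0 < ε) (n : ℕ) :
    estimateProb θ ε n true false + estimateProb θ ε n false true ≤ exp (-dExp θ ε) ^ n := by
  have hnn := reportProb_nonneg (θ := θ) (by linarith) hθ1.le (isStrategy_epsStrategy ε)
  rw [← sum_sqrt_reportProb hθ hθ1 hε]
  refine le_trans (le_of_eq ?_) (sum_min_prod_le (hnn false) (hnn true) n)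
  unfold estimateProb
  rw [← Finset.sum_add_distrib]
  refine Finset.sum_congr rfl fun y _ => ?_
  change _ = min (peerLikelihood θ ε false y) (peerLikelihood θ ε true y)
  by_cases h : peerLikelihood θ ε false y ≤ peerLikelihood θ ε true y
  · simp [peerEstimate, h]
  · simp [peerEstimate, h, min_eq_right (not_le.1 h).le]

theorem expPay_peerPayment (p θ ε : ℝ) {n : ℕ} (r : Bool → ℝ) (τ : Bool → Report → ℝ)
    (i : Fin (n + 1)) :
    expPay p θ (Function.update (fun _ => epsStrategy ε) i τ)
      (fun x i => peerPayment θ ε r (x i) (i.removeNth x)) i =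
      ∑ w : Bool, (if w then p else 1 - p) *
        ∑ b : Bool, reportProb θ τ w (some b) * (r b * estimateProb θ ε n w b) := by
  rw [expPay_update]
  refine Finset.sum_congr rfl fun w _ => ?_
  rw [Fintype.sum_option]
  simp only [peerPayment, reduceCtorEq, if_false, mul_zero, Finset.sum_const_zero, zero_add]
  congr 1
  refine Finset.sum_congr rfl fun b _ => ?_
  congr 1
  rw [estimateProb, Finset.mul_sum]
  refine Finset.sum_congr rfl fun y _ => ?_
  by_cases h : peerEstimate θ ε y = b
  · simp [h, peerLikelihood, mul_comm]
  · simp [h, Ne.symm h]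

/-- Prior probability of the estimate `b`. -/
noncomputable def marginalProb (p θ ε : ℝ) (n : ℕ) (b : Bool) : ℝ :=
  p * estimateProb θ ε n true b + (1 - p) * estimateProb θ ε n false b

/-- Covariance between an individual's signal and the estimate of her peers. -/
noncomputable def signalCov (p θ ε : ℝ) (n : ℕ) : ℝ :=
  p * (1 - p) * (2 * θ - 1) *
    (1 - (estimateProb θ ε n true false + estimateProb θ ε n false true))

/-- Rewards making the gain from reporting the signal rather than its opposite equal to `D`
for both signals. -/
noncomputable def reward (p θ ε D : ℝ) (n : ℕ) (b : Bool) : ℝ :=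
  D * marginalProb p θ ε n (!b) / signalCov p θ ε n

theorem expPay_reward {p θ ε D : ℝ} {n : ℕ} (hΔ : signalCov p θ ε n ≠ 0)
    {τ : Bool → Report → ℝ} (hτ : IsStrategy τ) (i : Fin (n + 1)) :
    expPay p θ (Function.update (fun _ => epsStrategy ε) i τ)
      (fun x i => peerPayment θ ε (reward p θ ε D n) (x i) (i.removeNth x)) i =
      D * marginalProb p θ ε n true * marginalProb p θ ε n false / signalCov p θ ε n +
        D * (τ false (some false) - τ true (some false)) -
        reward p θ ε D n true *
          ((p * θ * estimateProb θ ε n true true +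
              (1 - p) * (1 - θ) * estimateProb θ ε n false true) * τ true none +
            (p * (1 - θ) * estimateProb θ ε n true true +
              (1 - p) * θ * estimateProb θ ε n false true) * τ false none) := by
  rw [expPay_peerPayment]
  have s0 := hτ.2 false
  have s1 := hτ.2 true
  have ht : estimateProb θ ε n true true = 1 - estimateProb θ ε n true false := by
    linarith [estimateProb_add θ ε n true]
  have hf : estimateProb θ ε n false false = 1 - estimateProb θ ε n false true := by
    linarith [estimateProb_add θ ε n false]
  simp only [Fintype.sum_option, Fintype.sum_bool] at s0 s1
  have e0 : τ false none = 1 - τ false (some true) - τ false (some false) := by linarith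
  have e1 : τ true none = 1 - τ true (some true) - τ true (some false) := by linarith
  rw [e0, e1]
  simp only [Fintype.sum_bool, reportProb, signalProb, reward, marginalProb, Bool.not_true,
    Bool.not_false, if_true, reduceCtorEq, if_false, ht, hf]
  have hD : D * (τ false (some false) - τ true (some false)) =
      D * (τ false (some false) - τ true (some false)) * (p * (1 - p) * (2 * θ - 1) *
        (1 - (estimateProb θ ε n true false + estimateProb θ ε n false true))) /
        signalCov p θ ε n := (mul_div_cancel_right₀ _ hΔ).symm
  rw [hD]
  ring

theorem privCost_epsStrategy_le {g g' : ℝ → ℝ} (hg : ProperCost g g') {ε : ℝ} (hε : 0 < ε) :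
    privCost g (epsStrategy ε) ≤ (g ε : EReal) := by
  have h := privLevel_epsStrategy_le hε.le
  rw [privCost, if_neg (ne_top_of_le_ne_top ENNReal.ofReal_ne_top h)]
  exact_mod_cast hg.mono ENNReal.toReal_nonneg hε.le
    (ENNReal.toReal_le_of_le_ofReal hε.le h)

theorem ProperCost.deriv_pos {g g' : ℝ → ℝ} (hg : ProperCost g g') {ε : ℝ} (hε : 0 < ε) :
    0 < g' ε := by
  have h := hg.conv.tangent_le (Set.mem_Ici.2 hε.le) (Set.mem_Ici.2 le_rfl) (hg.deriv ε hε.le)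
  have := hg.pos ε hε
  rw [hg.zero] at h
  nlinarith

/-- The `ε`-strategy is optimal when an individual is paid the signal gain
`g'(ε)(e^ε+1)²/(2e^ε)` per unit of accuracy advantage. -/
theorem gain_sub_privCost_le {g g' : ℝ → ℝ} (hg : ProperCost g g') {ε D : ℝ} (hε : 0 < ε)
    (hD : D * (2 * exp ε / (exp ε + 1) ^ 2) = g' ε) (hD0 : 0 ≤ D)
    {τ : Bool → Report → ℝ} (hτ : IsStrategy τ) (K : ℝ) :
    ((K + D * (τ false (some false) - τ true (some false)) : ℝ) : EReal) - privCost g τ ≤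
      ((K + D * ((exp ε - 1) / (exp ε + 1)) : ℝ) : EReal) - (g ε : EReal) := by
  have hmem : ε ∈ Set.Ici (0 : ℝ) := hε.le
  by_cases h : privLevel τ = ⊤
  · have hpos := hg.deriv_pos hε
    have h0 : 0 ≤ D / g' ε := by positivity
    have hx : ε + D / g' ε ∈ Set.Ici (0 : ℝ) := add_nonneg hε.le h0
    have htan := hg.conv.tangent_le hmem hx (hg.deriv ε hmem)
    have hcost : (g (ε + D / g' ε) : EReal) ≤ privCost g τ := by
      rw [privCost, if_pos h]
      exact le_iSup₂_of_le _ hx le_rfl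
    refine (EReal.sub_le_sub le_rfl hcost).trans ?_
    norm_cast
    have e : g' ε * (ε + D / g' ε - ε) = D := by field_simp; ring
    have hb : τ false (some false) ≤ 1 := by
      rw [← hτ.2 false]
      exact Finset.single_le_sum (fun x _ => hτ.1 false x) (Finset.mem_univ _)
    have ha := hτ.1 true (some false)
    have hT : 0 ≤ (exp ε - 1) / (exp ε + 1) :=
      div_nonneg (sub_nonneg.2 (one_le_exp hε.le)) (by positivity)
    nlinarith [mul_nonneg hD0 hT, mul_nonneg hD0 (by linarith :
      0 ≤ 1 - (τ false (some false) - τ true (some false)))]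
  · rw [privCost, if_neg h]
    norm_cast
    have hx : (privLevel τ).toReal ∈ Set.Ici (0 : ℝ) := ENNReal.toReal_nonneg
    have htan := hg.conv.tangent_le hmem hx (hg.deriv ε hmem)
    have hadv := mul_le_mul_of_nonneg_left ((sub_le_of_privLevel hτ h).trans
      (tangent_ge_exp_sub_one_div_exp_add_one hε.le hx)) hD0
    rw [mul_add, ← mul_assoc, hD] at hadv
    linarith

theorem expPay_reward_epsStrategy {p θ ε D : ℝ} {n : ℕ} (hΔ : signalCov p θ ε n ≠ 0)
    (i : Fin (n + 1)) :
    expPay p θ (fun _ => epsStrategy ε)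
      (fun x i => peerPayment θ ε (reward p θ ε D n) (x i) (i.removeNth x)) i =
      D * marginalProb p θ ε n true * marginalProb p θ ε n false / signalCov p θ ε n +
        D * ((exp ε - 1) / (exp ε + 1)) := by
  have h := expPay_reward (D := D) hΔ (isStrategy_epsStrategy ε) i
  rw [Function.update_eq_self] at h
  have hgap : epsStrategy ε false (some false) - epsStrategy ε true (some false) =
      (exp ε - 1) / (exp ε + 1) := by
    simp [epsStrategy]
    ring
  have hnone : ∀ s, epsStrategy ε s none = 0 := fun _ => rfl
  rw [h, hgap, hnone, hnone]
  ring

theorem marginalProb_nonneg {p θ : ℝ} (ε : ℝ) (hp0 : 0 ≤ p) (hp1 : p ≤ 1) (hθ0 : 0 ≤ θ)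
    (hθ1 : θ ≤ 1) (n : ℕ) (b : Bool) : 0 ≤ marginalProb p θ ε n b :=
  add_nonneg (mul_nonneg hp0 (estimateProb_nonneg hθ0 hθ1 n _ _))
    (mul_nonneg (sub_nonneg.2 hp1) (estimateProb_nonneg hθ0 hθ1 n _ _))

theorem nashEq_peerPayment {p θ : ℝ} (hp0 : 0 ≤ p) (hp1 : p ≤ 1) (hθ0 : 0 ≤ θ) (hθ1 : θ ≤ 1)
    {g g' : ℝ → ℝ} (hg : ProperCost g g') {ε D : ℝ} (hε : 0 < ε)
    (hD : D * (2 * exp ε / (exp ε + 1) ^ 2) = g' ε) (hD0 : 0 ≤ D) {n : ℕ}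
    (hΔ : 0 < signalCov p θ ε n) :
    NashEq p θ g (fun _ : Fin (n + 1) => epsStrategy ε)
      (fun x i => peerPayment θ ε (reward p θ ε D n) (x i) (i.removeNth x)) := by
  refine ⟨fun _ => isStrategy_epsStrategy ε, fun i τ hτ => ?_⟩
  have hm := marginalProb_nonneg (p := p) (θ := θ) ε hp0 hp1 hθ0 hθ1 n
  have he := estimateProb_nonneg (θ := θ) (ε := ε) hθ0 hθ1 n
  have hr : 0 ≤ reward p θ ε D n true := div_nonneg (mul_nonneg hD0 (hm _)) hΔ.le
  unfold utility
  rw [Function.update_self, expPay_reward_epsStrategy hΔ.ne']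
  refine le_trans (EReal.sub_le_sub (EReal.coe_le_coe_iff.2 ?_) le_rfl)
    ((gain_sub_privCost_le hg hε hD hD0 hτ _).trans
      (EReal.sub_le_sub le_rfl (privCost_epsStrategy_le hg hε)))
  rw [expPay_reward hΔ.ne' hτ, sub_le_self_iff]
  have := hτ.1 true none
  have := hτ.1 false none
  have := he true true
  have := he false true
  have := sub_nonneg.2 hp1
  have := sub_nonneg.2 hθ1
  positivity

/-- The cost of estimating the state from peers with total error `x + y`. -/
theorem marginal_mul_div_cov_le {p θ x y κ : ℝ} (hp0 : 0 < p) (hp1 : p < 1) (hθ : 1 / 2 < θ)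
    (hx : 0 ≤ x) (hy : 0 ≤ y) (hκ : 0 < κ) (hxy : κ ≤ 1 - (x + y)) :
    (p * (1 - x) + (1 - p) * y) * (p * x + (1 - p) * (1 - y)) /
        (p * (1 - p) * (2 * θ - 1) * (1 - (x + y))) ≤
      1 / (2 * θ - 1) +
        (2 + p * (1 - p)) / (p * (1 - p) * (2 * θ - 1) * κ) * (x + y) := by
  have hq : 0 < 1 - p := by linarith
  have ht : 0 < 2 * θ - 1 := by linarith
  have hd : 0 < 1 - (x + y) := by linarith
  have hc : 0 < p * (1 - p) := mul_pos hp0 hq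
  have hnum : (p * (1 - x) + (1 - p) * y) * (p * x + (1 - p) * (1 - y)) ≤
      p * (1 - p) + 2 * (x + y) :=
    calc _ ≤ (p + (x + y)) * ((1 - p) + (x + y)) := by
          refine mul_le_mul ?_ ?_ ?_ ?_ <;> nlinarith
      _ ≤ _ := by nlinarith
  calc _ ≤ (p * (1 - p) + 2 * (x + y)) / (p * (1 - p) * (2 * θ - 1) * (1 - (x + y))) := by gcongr
    _ = 1 / (2 * θ - 1) + (2 + p * (1 - p)) / (p * (1 - p) * (2 * θ - 1) * (1 - (x + y))) *
          (x + y) := by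
        field_simp
        ring
    _ ≤ _ := by gcongr

/-- **Theorem 2 (upper bound on the value of privacy).**
For every `ε > 0` there is a constant `C > 0` such that for every `N ≥ 2` there is a
nonnegative payment mechanism in which the profile of `N` copies of the `ε`-strategy is
a Nash equilibrium and the expected payment to each individual at this equilibrium is at
most `V_LB(ε) + C·e^{−N·d}`, where `d > 0`. -/
theorem value_of_privacy_upper_bound
    (p θ : ℝ) (hp0 : 0 < p) (hp1 : p < 1)
    (hθ : 1/2 < θ) (hθ1 : θ < 1)
    (g g' : ℝ → ℝ) (hg : ProperCost g g')
    (ε : ℝ) (hε : 0 < ε) :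
    0 < dExp θ ε ∧
    ∃ C : ℝ, 0 < C ∧
      ∀ N : ℕ, 2 ≤ N →
        ∃ R : (Fin N → Report) → Fin N → ℝ,
          (∀ x i, 0 ≤ R x i) ∧
          NashEq p θ g (fun _ : Fin N => epsStrategy ε) R ∧
          ∀ i : Fin N,
            expPay p θ (fun _ : Fin N => epsStrategy ε) R i ≤
              VLB θ g' ε + C * Real.exp (-(N : ℝ) * dExp θ ε) := by
  have hd := dExp_pos hθ hθ1 hε
  have hg' := hg.deriv_pos hε
  have ht : 0 < 2 * θ - 1 := by linarith
  have hq : 0 < 1 - p := by linarith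
  have hκ : 0 < 1 - exp (-dExp θ ε) := sub_pos.2 (exp_lt_one_iff.2 (neg_neg_of_pos hd))
  obtain ⟨D, hD⟩ : ∃ D, D = g' ε * (exp ε + 1) ^ 2 / (2 * exp ε) := ⟨_, rfl⟩
  have hD0 : 0 < D := by rw [hD]; positivity
  have hDg : D * (2 * exp ε / (exp ε + 1) ^ 2) = g' ε := by rw [hD]; field_simp
  have hVLB : VLB θ g' ε = D * (1 / (2 * θ - 1)) + D * ((exp ε - 1) / (exp ε + 1)) := by
    rw [hD, VLB]
    have hθt : θ / (2 * θ - 1) = 1 / 2 + 1 / 2 * (1 / (2 * θ - 1)) := by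
      rw [div_eq_iff ht.ne', add_mul, mul_assoc, one_div_mul_cancel ht.ne']
      ring
    rw [hθt]
    generalize 1 / (2 * θ - 1) = t
    field_simp
    ring
  refine ⟨hd, D * ((2 + p * (1 - p)) /
    (p * (1 - p) * (2 * θ - 1) * (1 - exp (-dExp θ ε)))) * exp (dExp θ ε),
    by positivity, fun N hN => ?_⟩
  obtain ⟨n, rfl⟩ : ∃ n, N = n + 1 := ⟨N - 1, by omega⟩
  have herr := estimateProb_error_le hθ hθ1 hε n
  have hx := estimateProb_nonneg (ε := ε) (by linarith) hθ1.le n true false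
  have hy := estimateProb_nonneg (ε := ε) (by linarith) hθ1.le n false true
  have hxy : 1 - exp (-dExp θ ε) ≤
      1 - (estimateProb θ ε n true false + estimateProb θ ε n false true) :=
    sub_le_sub_left (herr.trans (pow_le_of_le_one (exp_pos _).le (by linarith) (by omega))) 1
  have hΔ : 0 < signalCov p θ ε n :=
    mul_pos (mul_pos (mul_pos hp0 hq) ht) (hκ.trans_le hxy)
  have hm := marginalProb_nonneg ε hp0.le hp1.le (by linarith) hθ1.le n
  refine ⟨fun x i => peerPayment θ ε (reward p θ ε D n) (x i) (i.removeNth x), fun x i => ?_,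
    nashEq_peerPayment hp0.le hp1.le (by linarith) hθ1.le hg hε hDg hD0.le hΔ, fun i => ?_⟩
  · dsimp only [peerPayment]
    split_ifs
    exacts [div_nonneg (mul_nonneg hD0.le (hm _)) hΔ.le, le_rfl]
  · have hmain := marginal_mul_div_cov_le hp0 hp1 hθ hx hy hκ hxy
    have hexp : exp (dExp θ ε) * exp (-((n + 1 : ℕ) : ℝ) * dExp θ ε) =
        exp (-dExp θ ε) ^ n := by
      rw [← exp_add, ← exp_nat_mul]
      congr 1
      push_cast
      ring
    have hmt : marginalProb p θ ε n true = p * (1 - estimateProb θ ε n true false) +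
        (1 - p) * estimateProb θ ε n false true := by
      rw [marginalProb, eq_sub_of_add_eq (estimateProb_add θ ε n true)]
    have hmf : marginalProb p θ ε n false = p * estimateProb θ ε n true false +
        (1 - p) * (1 - estimateProb θ ε n false true) := by
      rw [marginalProb, eq_sub_of_add_eq' (estimateProb_add θ ε n false)]
    rw [expPay_reward_epsStrategy hΔ.ne', hVLB, mul_assoc _ (exp _), hexp, mul_assoc D,
      mul_div_assoc, hmt, hmf, signalCov, add_right_comm, mul_assoc D, ← mul_add, ← mul_add, ← mul_add]
    gcongr
    exact hmain.trans (by gcongr)
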